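/- Let n ≥ 5 and 2 < j < n. A connected simple graph G of order n realizes the multiset S_{{2,j},n}^{n-1} (integers 0 through n with 2 and j removed, n−1 doubled) if and only if G = K₁ ∨ (K₁ ∪ H), where H is a graph on n−2 vertices realizing S_{{1,j-1},n-2}^{n-2}. -/

import Mathlib

open SimpleGraph Polynomial

/-- The multiset of Laplacian eigenvalues (roots of the characteristic polynomial of the
Laplacian matrix over `ℝ`, with multiplicity) of a simple graph. -/
noncomputable def lapSpec {V : Type*} [Fintype V] [DecidableEq V] (G : SimpleGraph V) :
    Multiset ℝ :=
  letI := Classical.decRel G.Adj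
  ((G.lapMatrix ℝ).charpoly).roots

/-- The disjoint union of two simple graphs. -/
def graphUnion {α β : Type*} (G : SimpleGraph α) (H : SimpleGraph β) : SimpleGraph (α ⊕ β) :=
  SimpleGraph.fromRel fun x y =>
    (∃ a b, x = Sum.inl a ∧ y = Sum.inl b ∧ G.Adj a b) ∨
    (∃ a b, x = Sum.inr a ∧ y = Sum.inr b ∧ H.Adj a b)

/-- The join of two simple graphs: the disjoint union together with all edges between the parts. -/
def graphJoin {α β : Type*} (G : SimpleGraph α) (H : SimpleGraph β) : SimpleGraph (α ⊕ β) :=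
  SimpleGraph.fromRel fun x y =>
    (∃ a b, x = Sum.inl a ∧ y = Sum.inl b ∧ G.Adj a b) ∨
    (∃ a b, x = Sum.inr a ∧ y = Sum.inr b ∧ H.Adj a b) ∨
    (∃ a b, x = Sum.inl a ∧ y = Sum.inr b)

/-- `G` is a join of two nonempty graphs. -/
def IsJoin {γ : Type*} [Fintype γ] (G : SimpleGraph γ) : Prop :=
  ∃ (p q : ℕ) (F : SimpleGraph (Fin p)) (H : SimpleGraph (Fin q)),
    0 < p ∧ 0 < q ∧ Nonempty (G ≃g graphJoin F H)

/-- The multiset `S_{{i,j},n}^m`: the integers `0,1,…,n` with `i` and `j` removed and an extra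
copy of `m` added (so `m` is counted twice), viewed as a multiset of reals. -/
def Sdouble (i j n m : ℕ) : Multiset ℝ :=
  ((m ::ₘ (((Finset.range (n + 1)).val.erase i).erase j)).map (fun k : ℕ => (k : ℝ)))

/-- The multiset `S_{j,n} = {0,1,…,n} \ {j}`, viewed as a multiset of reals. -/
def Ssingle (j n : ℕ) : Multiset ℝ :=
  (((Finset.range (n + 1)).val.erase j).map (fun k : ℕ => (k : ℝ)))

/-- The one-vertex graph `K₁`. -/
def K1 : SimpleGraph (Fin 1) := ⊥

/-- The complete graph `K₂` on two vertices. -/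
def K2 : SimpleGraph (Fin 2) := ⊤

lemma lapSpec_eq {V : Type*} [Fintype V] [DecidableEq V] (G : SimpleGraph V)
    [DecidableRel G.Adj] : lapSpec G = ((G.lapMatrix ℝ).charpoly).roots := by
  unfold lapSpec
  congr!

lemma lapMatrix_mulVec_eq_sum {V : Type*} [Fintype V] [DecidableEq V] (G : SimpleGraph V)
    [DecidableRel G.Adj] (x : V → ℝ) (i : V) :
    (G.lapMatrix ℝ).mulVec x i = ∑ j, if G.Adj i j then x i - x j else 0 := by
  rw [lapMatrix_mulVec_apply, ← Finset.sum_filter, Finset.sum_sub_distrib, Finset.sum_const,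
    nsmul_eq_mul, ← neighborFinset_eq_filter, card_neighborFinset_eq_degree]

lemma sum_lapMatrix_mulVec {V : Type*} [Fintype V] [DecidableEq V] (G : SimpleGraph V)
    [DecidableRel G.Adj] (x : V → ℝ) : ∑ i, (G.lapMatrix ℝ).mulVec x i = 0 := by
  have h : (1 : V → ℝ) ⬝ᵥ (G.lapMatrix ℝ).mulVec x = 0 := by
    rw [Matrix.dotProduct_mulVec, ← Matrix.mulVec_transpose, (G.isSymm_lapMatrix (R := ℝ)).eq]
    have := G.lapMatrix_mulVec_const_eq_zero (R := ℝ)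
    rw [show (1 : V → ℝ) = fun _ => 1 from rfl, this, zero_dotProduct]
  simpa [dotProduct] using h

lemma mem_lapSpec {V : Type*} [Fintype V] [DecidableEq V] (G : SimpleGraph V)
    [DecidableRel G.Adj] (μ : ℝ) :
    μ ∈ lapSpec G ↔ ∃ x : V → ℝ, x ≠ 0 ∧ (G.lapMatrix ℝ).mulVec x = μ • x := by
  rw [lapSpec_eq, mem_roots (Matrix.charpoly_monic _).ne_zero, IsRoot.def, Matrix.eval_charpoly,
    ← Matrix.exists_mulVec_eq_zero_iff]
  simp [Matrix.sub_mulVec, sub_eq_zero, eq_comm, Matrix.scalar_apply,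
    ← Matrix.smul_one_eq_diagonal, Matrix.smul_mulVec]

lemma lapSpec_congr {V W : Type*} [Fintype V] [DecidableEq V] [Fintype W] [DecidableEq W]
    {G : SimpleGraph V} {H : SimpleGraph W} (e : G ≃g H) : lapSpec G = lapSpec H := by
  classical
  rw [lapSpec_eq, lapSpec_eq, ← Matrix.charpoly_reindex e.toEquiv]
  congr 2
  ext i j
  have hd : G.degree (e.symm i) = H.degree i := e.symm.degree_eq i
  simp [lapMatrix, degMatrix, Matrix.diagonal_apply, adjMatrix_apply, hd,
    Iso.map_adj_iff, show (e.toEquiv.symm i) = e.symm i from rfl,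
    show (e.toEquiv.symm j) = e.symm j from rfl]

@[simp] lemma graphUnion_adj_inl_inl {α β : Type*} {G : SimpleGraph α} {H : SimpleGraph β}
    {a b : α} : (graphUnion G H).Adj (.inl a) (.inl b) ↔ G.Adj a b := by
  simpa [graphUnion, G.adj_comm b a] using fun h : G.Adj a b => h.ne

@[simp] lemma graphUnion_adj_inr_inr {α β : Type*} {G : SimpleGraph α} {H : SimpleGraph β}
    {a b : β} : (graphUnion G H).Adj (.inr a) (.inr b) ↔ H.Adj a b := by
  simpa [graphUnion, H.adj_comm b a] using fun h : H.Adj a b => h.ne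

@[simp] lemma graphUnion_adj_inl_inr {α β : Type*} {G : SimpleGraph α} {H : SimpleGraph β}
    {a : α} {b : β} : ¬ (graphUnion G H).Adj (.inl a) (.inr b) := by
  simp [graphUnion]

@[simp] lemma graphUnion_adj_inr_inl {α β : Type*} {G : SimpleGraph α} {H : SimpleGraph β}
    {a : β} {b : α} : ¬ (graphUnion G H).Adj (.inr a) (.inl b) := by
  simp [graphUnion]

@[simp] lemma graphJoin_adj_inl_inl {α β : Type*} {G : SimpleGraph α} {H : SimpleGraph β}
    {a b : α} : (graphJoin G H).Adj (.inl a) (.inl b) ↔ G.Adj a b := by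
  simpa [graphJoin, G.adj_comm b a] using fun h : G.Adj a b => h.ne

@[simp] lemma graphJoin_adj_inr_inr {α β : Type*} {G : SimpleGraph α} {H : SimpleGraph β}
    {a b : β} : (graphJoin G H).Adj (.inr a) (.inr b) ↔ H.Adj a b := by
  simpa [graphJoin, H.adj_comm b a] using fun h : H.Adj a b => h.ne

@[simp] lemma graphJoin_adj_inl_inr {α β : Type*} {G : SimpleGraph α} {H : SimpleGraph β}
    {a : α} {b : β} : (graphJoin G H).Adj (.inl a) (.inr b) := by
  simp [graphJoin]

@[simp] lemma graphJoin_adj_inr_inl {α β : Type*} {G : SimpleGraph α} {H : SimpleGraph β}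
    {a : β} {b : α} : (graphJoin G H).Adj (.inr a) (.inl b) := by
  simp [graphJoin]

lemma compl_graphUnion {α β : Type*} (G : SimpleGraph α) (H : SimpleGraph β) :
    (graphUnion G H)ᶜ = graphJoin Gᶜ Hᶜ := by
  ext (a | a) (b | b) <;> simp

/-- Isomorphic second factors give isomorphic joins. -/
def graphJoinCongrRight {α β γ : Type*} (G : SimpleGraph α) {H : SimpleGraph β}
    {K : SimpleGraph γ} (e : H ≃g K) : graphJoin G H ≃g graphJoin G K where
  toEquiv := Equiv.sumCongr (Equiv.refl α) e.toEquiv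
  map_rel_iff' := by
    rintro (a | a) (b | b) <;> simp [e.map_adj_iff]

lemma compl_K1 : K1ᶜ = K1 := Subsingleton.elim _ _

lemma lapSpec_K1 : lapSpec K1 = {0} := by
  classical
  have h : K1.lapMatrix ℝ = 0 := by
    rw [← Matrix.mulVec_injective.eq_iff]
    ext x i
    rw [lapMatrix_mulVec_eq_sum]
    simp [K1]
  rw [lapSpec_eq, h]
  simp

lemma lapSpec_graphUnion {α β : Type*} [Fintype α] [DecidableEq α] [Fintype β] [DecidableEq β]
    (G : SimpleGraph α) (H : SimpleGraph β) :
    lapSpec (graphUnion G H) = lapSpec G + lapSpec H := by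
  classical
  have h : (graphUnion G H).lapMatrix ℝ
      = Matrix.fromBlocks (G.lapMatrix ℝ) 0 0 (H.lapMatrix ℝ) := by
    rw [← Matrix.mulVec_injective.eq_iff]
    ext x (i | i) <;> simp [lapMatrix_mulVec_eq_sum, Matrix.fromBlocks_mulVec]
  rw [lapSpec_eq, lapSpec_eq, lapSpec_eq, h, Matrix.charpoly_fromBlocks_zero₁₂, roots_mul]
  exact mul_ne_zero (Matrix.charpoly_monic _).ne_zero (Matrix.charpoly_monic _).ne_zero

lemma lapMatrix_compl {V : Type*} [Fintype V] [DecidableEq V] (G : SimpleGraph V)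
    [DecidableRel G.Adj] :
    Gᶜ.lapMatrix ℝ = (Fintype.card V : ℝ) • 1 - Matrix.of (fun _ _ => 1) - G.lapMatrix ℝ := by
  rw [← Matrix.mulVec_injective.eq_iff]
  ext x i
  have h : ∑ j, (x i - x j) = (Gᶜ.lapMatrix ℝ).mulVec x i + (G.lapMatrix ℝ).mulVec x i := by
    rw [lapMatrix_mulVec_eq_sum, lapMatrix_mulVec_eq_sum, ← Finset.sum_add_distrib]
    refine Finset.sum_congr rfl fun j _ => ?_
    by_cases hij : i = j
    · simp [hij]
    · by_cases hG : G.Adj i j <;> simp [hij, hG]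
  have h2 : (Matrix.of (fun _ _ => (1 : ℝ)) : Matrix V V ℝ).mulVec x i = ∑ j, x j := by
    simp [Matrix.mulVec, dotProduct]
  rw [Matrix.sub_mulVec, Matrix.sub_mulVec, Matrix.smul_mulVec, Matrix.one_mulVec]
  simp only [Pi.sub_apply, Pi.smul_apply, smul_eq_mul, h2]
  rw [Finset.sum_sub_distrib, Finset.sum_const, nsmul_eq_mul, Finset.card_univ] at h
  linarith

lemma compl_lapMatrix_mulVec {V : Type*} [Fintype V] [DecidableEq V] (G : SimpleGraph V)
    [DecidableRel G.Adj] (x : V → ℝ) :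
    (Gᶜ.lapMatrix ℝ).mulVec x =
      (Fintype.card V : ℝ) • x - (fun _ => ∑ j, x j) - (G.lapMatrix ℝ).mulVec x := by
  rw [lapMatrix_compl, Matrix.sub_mulVec, Matrix.sub_mulVec, Matrix.smul_mulVec,
    Matrix.one_mulVec]
  congr 2
  ext i
  simp [Matrix.mulVec, dotProduct]

lemma det_sub_ones {V : Type*} [Fintype V] [DecidableEq V] (A : Matrix V V ℝ) {t : ℝ}
    (ht : t ≠ 0) (hA : A.mulVec (fun _ => 1) = fun _ => t) :
    t * (A - Matrix.of (fun _ _ => 1)).det = (t - Fintype.card V) * A.det := by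
  have hJ : A * Matrix.replicateCol Unit (fun _ : V => (1 : ℝ))
      = Matrix.replicateCol Unit (fun _ : V => t) := by
    rw [← Matrix.replicateCol_mulVec, hA]
  have hfac : A - Matrix.of (fun _ _ => 1)
      = A * (1 + Matrix.replicateCol Unit (fun _ : V => (1 : ℝ)) *
          Matrix.replicateRow Unit (fun _ : V => -t⁻¹)) := by
    rw [Matrix.mul_add, ← Matrix.mul_assoc, hJ, Matrix.mul_one, sub_eq_add_neg]
    congr 1
    ext i j
    simp [Matrix.mul_apply, ht]
  rw [hfac, Matrix.det_mul, Matrix.det_one_add_replicateCol_mul_replicateRow]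
  simp [dotProduct]
  field_simp
  ring

lemma det_smul_one_sub_lapMatrix_sub_ones {V : Type*} [Fintype V] [DecidableEq V]
    (G : SimpleGraph V) [DecidableRel G.Adj] (t : ℝ) :
    t * (t • 1 - G.lapMatrix ℝ - Matrix.of (fun _ _ => 1)).det
      = (t - Fintype.card V) * (t • 1 - G.lapMatrix ℝ).det := by
  rcases eq_or_ne t 0 with rfl | ht
  · rcases isEmpty_or_nonempty V with hV | hV
    · simp
    · simp [Matrix.det_neg]
  · refine det_sub_ones _ ht ?_
    rw [Matrix.sub_mulVec, G.lapMatrix_mulVec_const_eq_zero, Matrix.smul_mulVec,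
      Matrix.one_mulVec]
    ext
    simp

/-- The complement spectrum theorem. -/
lemma lapSpec_compl {V : Type*} [Fintype V] [DecidableEq V] (G : SimpleGraph V) :
    (Fintype.card V : ℝ) ::ₘ lapSpec Gᶜ
      = 0 ::ₘ (lapSpec G).map (fun t => (Fintype.card V : ℝ) - t) := by
  classical
  set n : ℝ := (Fintype.card V : ℝ) with hn
  have hG : (G.lapMatrix ℝ).charpoly ≠ 0 := (Matrix.charpoly_monic _).ne_zero
  have hGc : (Gᶜ.lapMatrix ℝ).charpoly ≠ 0 := (Matrix.charpoly_monic _).ne_zero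
  have key : (X - C n) * (Gᶜ.lapMatrix ℝ).charpoly
      = C ((-1) ^ Fintype.card V) * (X * (G.lapMatrix ℝ).charpoly.comp (C n - X)) := by
    refine Polynomial.funext fun t => ?_
    have h := det_smul_one_sub_lapMatrix_sub_ones G (n - t)
    have h2 : (t • 1 - Gᶜ.lapMatrix ℝ).det = (-1) ^ Fintype.card V *
        ((n - t) • 1 - G.lapMatrix ℝ - Matrix.of (fun _ _ => 1)).det := by
      rw [← Matrix.det_neg, lapMatrix_compl]
      congr 1
      module
    simp only [eval_mul, eval_sub, eval_X, eval_C, eval_comp, Matrix.eval_charpoly,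
      Matrix.scalar_apply, ← Matrix.smul_one_eq_diagonal]
    rw [h2]
    linear_combination (-(-1) ^ Fintype.card V) * h
  have hcomp : ((G.lapMatrix ℝ).charpoly.comp (C n - X)).roots
      = (lapSpec G).map (fun t => n - t) := by
    have hH := G.isHermitian_lapMatrix (R := ℝ)
    have hp : (G.lapMatrix ℝ).charpoly.comp (C n - X)
        = C ((-1) ^ Fintype.card V) * ∏ i, (X - C (n - hH.eigenvalues i)) := by
      rw [hH.charpoly_eq, Polynomial.prod_comp, C_pow, ← Finset.card_univ, ← Finset.prod_const,
        ← Finset.prod_mul_distrib]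
      refine Finset.prod_congr rfl fun i _ => ?_
      simp [sub_right_comm]
    have hroots (f : V → ℝ) : (∏ i, (X - C (f i))).roots = Finset.univ.val.map f := by
      rw [roots_prod _ _ (Finset.prod_ne_zero_iff.mpr fun i _ => X_sub_C_ne_zero _)]
      simp
    rw [lapSpec_eq, hp, hH.charpoly_eq, roots_C_mul _ (pow_ne_zero _ (by norm_num)), hroots]
    erw [hroots]
    rw [Multiset.map_map]
    rfl
  have hne : (G.lapMatrix ℝ).charpoly.comp (C n - X) ≠ 0 := by
    intro h0
    rw [h0, mul_zero, mul_zero] at key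
    exact mul_ne_zero (X_sub_C_ne_zero n) hGc key
  have := congrArg roots key
  rw [roots_mul (mul_ne_zero (X_sub_C_ne_zero n) hGc), roots_X_sub_C,
    roots_C_mul _ (pow_ne_zero _ (by norm_num)), roots_mul (mul_ne_zero X_ne_zero hne), roots_X,
    hcomp, ← lapSpec_eq] at this
  simpa using this

/-- Isomorphic graphs have isomorphic complements. -/
def isoCompl {V W : Type*} {G : SimpleGraph V} {H : SimpleGraph W} (e : G ≃g H) : Gᶜ ≃g Hᶜ where
  toEquiv := e.toEquiv
  map_rel_iff' := by simp [e.map_adj_iff]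

lemma lapSpec_graphJoin_K1 {α : Type*} [Fintype α] [DecidableEq α] (F : SimpleGraph α) :
    1 ::ₘ lapSpec (graphJoin K1 F)
      = 0 ::ₘ (Fintype.card α + 1 : ℝ) ::ₘ (lapSpec F).map (fun t => t + 1) := by
  have h1 := lapSpec_compl (graphJoin K1 F)
  have h2 := lapSpec_compl F
  have hc : (graphJoin K1 F)ᶜ = graphUnion K1 Fᶜ := by
    rw [← compl_compl (graphUnion K1 Fᶜ), compl_graphUnion, compl_K1, compl_compl]
  rw [hc, lapSpec_graphUnion, lapSpec_K1, Multiset.singleton_add, Multiset.cons_swap,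
    Multiset.cons_inj_right] at h1
  simp only [Fintype.card_sum, Fintype.card_fin, Nat.cast_add, Nat.cast_one] at h1 h2
  have h3 := congrArg (Multiset.map (fun t : ℝ => 1 + Fintype.card α - t)) h1
  have h4 := congrArg (Multiset.map (fun t : ℝ => 1 + Fintype.card α - t)) h2
  simp only [Multiset.map_cons, Multiset.map_map, Function.comp_def, sub_sub_cancel,
    Multiset.map_id', sub_self, sub_zero, add_sub_cancel_right] at h3 h4
  rw [← h3, Multiset.cons_swap, h4, add_comm (1 : ℝ)]
  rw [show (fun t : ℝ => (Fintype.card α : ℝ) + 1 - (Fintype.card α - t)) = fun t => t + 1 from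
    funext fun t => by ring]

lemma lapSpec_graphJoin_K1_graphUnion_K1 {α : Type*} [Fintype α] [DecidableEq α]
    (H : SimpleGraph α) :
    lapSpec (graphJoin K1 (graphUnion K1 H))
      = 0 ::ₘ (Fintype.card α + 2 : ℝ) ::ₘ (lapSpec H).map (fun t => t + 1) := by
  have h := lapSpec_graphJoin_K1 (graphUnion K1 H)
  rw [lapSpec_graphUnion, lapSpec_K1, Multiset.singleton_add, Multiset.map_cons, zero_add,
    Multiset.cons_swap _ 1, Multiset.cons_swap _ 1, Multiset.cons_inj_right] at h
  rw [h]
  simp only [Fintype.card_sum, Fintype.card_fin, Nat.cast_add, Nat.cast_one]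
  congr! 2
  ring

lemma sum_eq_zero_of_lapMatrix_mulVec_eq_smul {V : Type*} [Fintype V] [DecidableEq V]
    {G : SimpleGraph V} [DecidableRel G.Adj] {x : V → ℝ} {μ : ℝ} (hμ : μ ≠ 0)
    (hx : (G.lapMatrix ℝ).mulVec x = μ • x) : ∑ i, x i = 0 := by
  have h := sum_lapMatrix_mulVec G x
  rw [hx] at h
  simpa [← Finset.mul_sum, hμ] using h

/-- The order of a graph is an eigenvalue of its complement exactly when the graph is
disconnected. -/
lemma card_mem_lapSpec_compl_iff {V : Type*} [Fintype V] [DecidableEq V] [Nonempty V]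
    (G : SimpleGraph V) : (Fintype.card V : ℝ) ∈ lapSpec Gᶜ ↔ ¬ G.Preconnected := by
  classical
  have hn : (Fintype.card V : ℝ) ≠ 0 := by simp
  rw [mem_lapSpec]
  constructor
  · rintro ⟨x, hx0, hx⟩ hG
    have hs := sum_eq_zero_of_lapMatrix_mulVec_eq_smul hn hx
    rw [compl_lapMatrix_mulVec, hs] at hx
    have hL : (G.lapMatrix ℝ).mulVec x = 0 := by
      ext i
      have := congrFun hx i
      simp only [Pi.sub_apply, Pi.smul_apply, smul_eq_mul] at this
      simp only [Pi.zero_apply]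
      linarith
    rw [lapMatrix_mulVec_eq_zero_iff_forall_reachable] at hL
    refine hx0 (funext fun i => ?_)
    rw [Finset.sum_congr rfl fun j _ => hL j i (hG j i)] at hs
    simpa using hs
  · intro hG
    simp only [Preconnected, not_forall] at hG
    obtain ⟨a, b, hab⟩ := hG
    set z : V → ℝ := fun v => if G.Reachable a v then 1 else 0 with hz
    set m : ℝ := (∑ v, z v) / Fintype.card V with hm
    set x : V → ℝ := fun v => z v - m with hx
    have hL : (G.lapMatrix ℝ).mulVec x = 0 := by
      rw [lapMatrix_mulVec_eq_zero_iff_forall_reachable]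
      intro i j hij
      have : G.Reachable a i ↔ G.Reachable a j := ⟨fun h => h.trans hij, fun h => h.trans hij.symm⟩
      simp [hx, hz, this]
    have hs : ∑ v, x v = 0 := by
      simp only [hx, Finset.sum_sub_distrib, Finset.sum_const, Finset.card_univ, nsmul_eq_mul, hm]
      field_simp
      ring
    refine ⟨x, fun h0 => ?_, ?_⟩
    · have ha := congrFun h0 a
      have hb := congrFun h0 b
      simp only [hx, hz, Reachable.refl, hab, if_true, if_false, Pi.zero_apply] at ha hb
      linarith
    · rw [compl_lapMatrix_mulVec, hL, hs]
      ext
      simp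

lemma sum_sum_sub_sq_le {V : Type*} (T : Finset V) (x : V → ℝ) :
    ∑ i ∈ T, ∑ j ∈ T, (x i - x j) ^ 2 ≤ 2 * (T.card * ∑ i ∈ T, x i ^ 2) := by
  have h : ∑ i ∈ T, ∑ j ∈ T, (x i - x j) ^ 2
      = 2 * (T.card * ∑ i ∈ T, x i ^ 2) - 2 * (∑ i ∈ T, x i) ^ 2 := by
    simp only [sub_sq, Finset.sum_add_distrib, Finset.sum_sub_distrib, Finset.sum_const,
      nsmul_eq_mul, ← Finset.mul_sum, ← Finset.sum_mul]
    ring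
  nlinarith [sq_nonneg (∑ i ∈ T, x i)]

/-- An eigenvalue with an eigenvector not vanishing on a union of components is at most the
number of vertices of that union. -/
lemma eigenvalue_le_card_of_closed {V : Type*} [Fintype V] [DecidableEq V] {G : SimpleGraph V}
    [DecidableRel G.Adj] {x : V → ℝ} {μ : ℝ} (hx : (G.lapMatrix ℝ).mulVec x = μ • x)
    (T : Finset V) (hT : ∀ u v, G.Adj u v → (u ∈ T ↔ v ∈ T)) (hxT : ∃ v ∈ T, x v ≠ 0) :
    μ ≤ T.card := by
  have hpos : 0 < ∑ i ∈ T, x i ^ 2 := by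
    obtain ⟨v, hv, hxv⟩ := hxT
    exact Finset.sum_pos' (fun i _ => sq_nonneg _) ⟨v, hv, by positivity⟩
  set y : V → ℝ := fun i => if i ∈ T then x i else 0 with hy
  have hLy : (G.lapMatrix ℝ).mulVec y = μ • y := by
    ext i
    rw [lapMatrix_mulVec_eq_sum]
    by_cases hi : i ∈ T
    · have := congrFun hx i
      rw [lapMatrix_mulVec_eq_sum] at this
      simp only [Pi.smul_apply, hy, hi, if_true] at this ⊢
      rw [← this]
      refine Finset.sum_congr rfl fun j _ => ?_
      by_cases hij : G.Adj i j
      · simp [hij, (hT i j hij).1 hi]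
      · simp [hij]
    · simp only [Pi.smul_apply, hy, hi, if_false, smul_zero]
      refine Finset.sum_eq_zero fun j _ => ?_
      by_cases hij : G.Adj i j
      · simp [hij, (hT i j hij).not.1 hi]
      · simp [hij]
  have hq := G.lapMatrix_toLinearMap₂' ℝ y
  rw [Matrix.toLinearMap₂'_apply', hLy, dotProduct_smul] at hq
  have hyy : y ⬝ᵥ y = ∑ i ∈ T, x i ^ 2 := by
    simp [dotProduct, hy, ← sq, Finset.sum_ite_mem]
  have hle : ∑ i, ∑ j, (if G.Adj i j then (y i - y j) ^ 2 else 0)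
      ≤ ∑ i ∈ T, ∑ j ∈ T, (x i - x j) ^ 2 := by
    have hR : ∑ i ∈ T, ∑ j ∈ T, (x i - x j) ^ 2
        = ∑ i, if i ∈ T then ∑ j, if j ∈ T then (x i - x j) ^ 2 else 0 else 0 := by
      simp [Finset.sum_ite_mem]
    rw [hR]
    refine Finset.sum_le_sum fun i _ => ?_
    by_cases hi : i ∈ T
    · rw [if_pos hi]
      refine Finset.sum_le_sum fun j _ => ?_
      by_cases hij : G.Adj i j
      · simp [hij, hy, hi, (hT i j hij).1 hi]
      · rw [if_neg hij]
        positivity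
    · rw [if_neg hi]
      refine (Finset.sum_eq_zero fun j _ => ?_).le
      by_cases hij : G.Adj i j
      · simp [hij, hy, hi, (hT i j hij).not.1 hi]
      · simp [hij]
  have := sum_sum_sub_sq_le T x
  rw [hyy, smul_eq_mul] at hq
  nlinarith

/-- A disconnected graph with an eigenvalue at least its order minus one has an isolated
vertex. -/
lemma exists_isolated {V : Type*} [Fintype V] [DecidableEq V] {G : SimpleGraph V} {k : ℕ}
    (hk : Fintype.card V = k + 1) (hG : ¬ G.Preconnected) (hmem : (k : ℝ) ∈ lapSpec G) :
    ∃ v, ∀ w, ¬ G.Adj v w := by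
  classical
  obtain ⟨x, hx0, hx⟩ := (mem_lapSpec G _).1 hmem
  simp only [Preconnected, not_forall] at hG
  obtain ⟨a, b, hab⟩ := hG
  have key (T : Finset V) (hT : ∀ u v, G.Adj u v → (u ∈ T ↔ v ∈ T)) (hxT : ∃ v ∈ T, x v ≠ 0)
      (hne : ∃ v, v ∉ T) : ∃ v, ∀ w, ¬ G.Adj v w := by
    have h1 : k ≤ T.card := by exact_mod_cast eigenvalue_le_card_of_closed hx T hT hxT
    have h2 : Tᶜ.card ≤ 1 := by
      rw [Finset.card_compl]
      omega
    obtain ⟨v, hv⟩ := hne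
    refine ⟨v, fun w hvw => hvw.ne (Finset.card_le_one.1 h2 _ ?_ _ ?_)⟩
    · simpa using hv
    · simpa using (hT v w hvw).not.1 hv
  set T : Finset V := Finset.univ.filter fun v => G.Reachable a v with hTdef
  have hT : ∀ u v, G.Adj u v → (u ∈ T ↔ v ∈ T) := by
    intro u v huv
    simp only [hTdef, Finset.mem_filter_univ]
    exact ⟨fun h => h.trans huv.reachable, fun h => h.trans huv.symm.reachable⟩
  obtain ⟨v, hv⟩ := Function.ne_iff.1 hx0
  by_cases hvT : v ∈ T
  · exact key T hT ⟨v, hvT, hv⟩ ⟨b, by simpa [hTdef] using hab⟩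
  · refine key Tᶜ (fun u w huw => ?_) ⟨v, by simpa using hvT, hv⟩ ⟨a, by simp [hTdef]⟩
    simpa using (hT u w huw).not

lemma exists_iso_graphUnion_K1 {V : Type*} [Fintype V] [DecidableEq V] {G : SimpleGraph V} {k : ℕ}
    (hk : Fintype.card V = k + 1) {v : V} (hv : ∀ w, ¬ G.Adj v w) :
    ∃ H : SimpleGraph (Fin k), Nonempty (G ≃g graphUnion K1 H) := by
  obtain ⟨e₀⟩ : Nonempty (Fin 1 ⊕ Fin k ≃ V) := by
    rw [← Fintype.card_eq]
    simp [hk, add_comm]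
  set e : Fin 1 ⊕ Fin k ≃ V := e₀.trans (Equiv.swap (e₀ (.inl 0)) v) with he
  have hev : ∀ i, e (.inl i) = v := by
    intro i
    rw [Subsingleton.elim i 0]
    simp [he]
  refine ⟨G.comap (fun i => e (.inr i)), ⟨Iso.symm ⟨e, ?_⟩⟩⟩
  rintro (i | i) (j | j)
  · simp [hev, K1]
  · simp [hev, hv]
  · simp [hev, G.adj_comm _ v, hv]
  · simp

lemma exists_iso_graphUnion_K1_of_mem_lapSpec {V : Type*} [Fintype V] [DecidableEq V]
    {G : SimpleGraph V} {k : ℕ} (hk : Fintype.card V = k + 1) (hG : ¬ G.Preconnected)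
    (hmem : (k : ℝ) ∈ lapSpec G) :
    ∃ H : SimpleGraph (Fin k), Nonempty (G ≃g graphUnion K1 H) :=
  have ⟨_, hv⟩ := exists_isolated hk hG hmem
  exists_iso_graphUnion_K1 hk hv

lemma connected_of_count_zero_lapSpec {V : Type*} [Fintype V] [DecidableEq V] [Nonempty V]
    {G : SimpleGraph V} (h : (lapSpec G).count 0 = 1) : G.Connected := by
  rw [connected_iff]
  refine ⟨?_, ‹_›⟩
  by_contra hG
  have hn : (Fintype.card V : ℝ) ≠ 0 := by simp
  have hmem := Multiset.one_le_count_iff_mem.2 ((card_mem_lapSpec_compl_iff G).2 hG)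
  have hc := congrArg (Multiset.count (Fintype.card V : ℝ)) (lapSpec_compl G)
  have hmap := Multiset.count_map_eq_count' (fun t => (Fintype.card V : ℝ) - t) (lapSpec G)
    (sub_right_injective) 0
  rw [sub_zero] at hmap
  rw [Multiset.count_cons_self, Multiset.count_cons_of_ne hn, hmap, h] at hc
  omega

lemma Sdouble_two (k j : ℕ) (hk : 3 ≤ k) (hj2 : 2 < j) (hjk : j < k + 2) :
    Sdouble 2 j (k + 2) (k + 1)
      = 0 ::ₘ (k + 2 : ℝ) ::ₘ (Sdouble 1 (j - 1) k k).map (fun t => t + 1) := by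
  have h : (((Finset.range (k + 2 + 1)).val.erase 2).erase j)
      = 0 ::ₘ (k + 2) ::ₘ (((Finset.range (k + 1)).val.erase 1).erase (j - 1)).map (· + 1) := by
    refine (Multiset.Nodup.ext ?_ ?_).2 fun a => ?_
    · exact ((Finset.nodup _).erase _).erase _
    · refine Multiset.nodup_cons.2 ⟨by simp, Multiset.nodup_cons.2 ⟨?_, ?_⟩⟩
      · intro hm
        obtain ⟨b, hb, hbk⟩ := Multiset.mem_map.1 hm
        have := Finset.mem_range.1 (Multiset.mem_of_mem_erase (Multiset.mem_of_mem_erase hb))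
        omega
      · exact ((((Finset.nodup _).erase _).erase _).map (add_left_injective 1))
    · simp only [Multiset.mem_cons, Multiset.mem_map, ((Finset.nodup _).erase _).mem_erase_iff,
        (Finset.nodup _).mem_erase_iff, Finset.mem_val, Finset.mem_range]
      constructor
      · intro ha
        by_cases h0 : a = 0
        · exact .inl h0
        by_cases h2 : a = k + 2
        · exact .inr (.inl h2)
        exact .inr (.inr ⟨a - 1, by omega, by omega⟩)
      · rintro (rfl | rfl | ⟨b, hb, rfl⟩) <;> omega
  rw [Sdouble, Sdouble, h, Multiset.cons_swap, Multiset.cons_swap (k + 1)]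
  simp [Multiset.map_map]

lemma count_zero_Sdouble_one (k j : ℕ) (hk : 0 < k) (hj : 0 < j) :
    (Sdouble 1 j k k).count 0 = 1 := by
  have h := Multiset.count_map_eq_count' (fun k : ℕ => (k : ℝ))
    (k ::ₘ (((Finset.range (k + 1)).val.erase 1).erase j)) Nat.cast_injective 0
  rw [Nat.cast_zero] at h
  rw [Sdouble, h, Multiset.count_cons_of_ne hk.ne, Multiset.count_erase_of_ne hj.ne,
    Multiset.count_erase_of_ne (by norm_num)]
  exact Multiset.count_eq_one_of_mem (Finset.nodup _) (Finset.mem_range.2 k.succ_pos)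

/-- For `n ≥ 5` and `2 < j < n`, a connected graph `G` of order `n` realizes
`S_{{2,j},n}^{n-1}` if and only if `G = K₁ ∨ (K₁ ∪ H)` where `H` is a graph on `n - 2`
vertices realizing `S_{{1,j-1},n-2}^{n-2}`. -/
theorem realizes_S2j_iff {V : Type*} [Fintype V] [DecidableEq V] (G : SimpleGraph V)
    (n j : ℕ) (hn : 5 ≤ n) (hcard : Fintype.card V = n) (hG : G.Connected)
    (hj2 : 2 < j) (hjn : j < n) :
    lapSpec G = Sdouble 2 j n (n - 1) ↔
      ∃ H : SimpleGraph (Fin (n - 2)), H.Connected ∧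
        lapSpec H = Sdouble 1 (j - 1) (n - 2) (n - 2) ∧
        Nonempty (G ≃g graphJoin K1 (graphUnion K1 H)) := by
  obtain ⟨k, rfl⟩ : ∃ k, n = k + 2 := ⟨n - 2, by omega⟩
  simp only [Nat.add_sub_cancel, show k + 2 - 1 = k + 1 from rfl]
  have : Nonempty V := hG.nonempty
  have hk0 : (0 : ℝ) < k := by exact_mod_cast (by omega : 0 < k)
  have hS := Sdouble_two k j (by omega) hj2 hjn
  have hspec (H : SimpleGraph (Fin k)) (e : G ≃g graphJoin K1 (graphUnion K1 H)) :
      lapSpec G = 0 ::ₘ (k + 2 : ℝ) ::ₘ (lapSpec H).map (fun t => t + 1) := by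
    rw [lapSpec_congr e, lapSpec_graphJoin_K1_graphUnion_K1, Fintype.card_fin]
  constructor
  · intro hGS
    have hGc : ¬ Gᶜ.Preconnected := by
      rw [← card_mem_lapSpec_compl_iff, compl_compl, hcard, hGS, hS]
      simp
    have hmem1 : (1 : ℝ) ∈ lapSpec G := by
      rw [hGS]
      exact Multiset.mem_map.2 ⟨1, Multiset.mem_cons_of_mem <|
        (Multiset.mem_erase_of_ne (by omega)).2 <| (Multiset.mem_erase_of_ne (by omega)).2 <|
          Finset.mem_range.2 (by omega), Nat.cast_one⟩
    have hmemG : ((k + 1 : ℕ) : ℝ) ∈ lapSpec G := by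
      rw [hGS]
      exact Multiset.mem_map_of_mem _ (Multiset.mem_cons_self _ _)
    have hmemGc : ((k + 1 : ℕ) : ℝ) ∈ lapSpec Gᶜ := by
      have h : ((k + 1 : ℕ) : ℝ) ∈ ((Fintype.card V : ℕ) : ℝ) ::ₘ lapSpec Gᶜ := by
        rw [lapSpec_compl, hcard]
        refine Multiset.mem_cons_of_mem (Multiset.mem_map.2 ⟨1, hmem1, ?_⟩)
        push_cast
        ring
      refine (Multiset.mem_cons.1 h).resolve_left ?_
      rw [hcard, Nat.cast_inj]
      omega
    obtain ⟨M, ⟨eM⟩⟩ := exists_iso_graphUnion_K1_of_mem_lapSpec hcard hGc hmemGc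
    have eG : G ≃g graphJoin K1 Mᶜ := by
      have e := isoCompl eM
      rwa [compl_compl, compl_graphUnion, compl_K1] at e
    have hM : ¬ Mᶜ.Preconnected := by
      rw [← card_mem_lapSpec_compl_iff, compl_compl, Fintype.card_fin]
      rw [lapSpec_congr eM, lapSpec_graphUnion, lapSpec_K1] at hmemGc
      refine (Multiset.mem_cons.1 hmemGc).resolve_left ?_
      exact_mod_cast k.succ_ne_zero
    have hmemM : (k : ℝ) ∈ lapSpec Mᶜ := by
      have h := Multiset.mem_cons_of_mem (b := 1) hmemG
      rw [lapSpec_congr eG, lapSpec_graphJoin_K1, Fintype.card_fin] at h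
      simp only [Multiset.mem_cons, Multiset.mem_map] at h
      push_cast at h
      rcases h with h | h | ⟨t, ht, h⟩
      · linarith
      · linarith
      · rwa [add_right_cancel h] at ht
    obtain ⟨H, ⟨eH⟩⟩ := exists_iso_graphUnion_K1_of_mem_lapSpec (Fintype.card_fin _) hM hmemM
    have e : G ≃g graphJoin K1 (graphUnion K1 H) := eG.trans (graphJoinCongrRight K1 eH)
    have hH : lapSpec H = Sdouble 1 (j - 1) k k := by
      rw [hspec H e, hS, Multiset.cons_inj_right, Multiset.cons_inj_right] at hGS
      exact Multiset.map_injective (add_left_injective (1 : ℝ)) hGS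
    have : Nonempty (Fin (k + 2 - 2)) := ⟨⟨0, by omega⟩⟩
    refine ⟨H, connected_of_count_zero_lapSpec ?_, hH, ⟨e⟩⟩
    rw [hH, count_zero_Sdouble_one k (j - 1) (by omega) (by omega)]
  · rintro ⟨H, -, hH, ⟨e⟩⟩
    rw [hspec H e, hH, hS]
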